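/- Let n ≥ 3 be odd and set α = (n−1)/2. The polynomial p(x) = 1 − x − Σ_{i=1}^{α} 2x^{i+1} has a unique real root r in the open interval (0,1) (which is its root of smallest magnitude), and the growth rate of BS(1,n) equals its reciprocal: lim_{N→∞} |S_n(N)|^{1/N} = 1/r. -/

import Mathlib

open Filter Topology

abbrev Letter : Type := Fin 2 × Bool

def bsRels (n : ℕ) : Set (FreeGroup (Fin 2)) :=
  {FreeGroup.of 1 * FreeGroup.of 0 * (FreeGroup.of 1)⁻¹ * (FreeGroup.of 0 ^ n)⁻¹}

abbrev BS (n : ℕ) : Type := PresentedGroup (bsRels n)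

def bsA (n : ℕ) : BS n := PresentedGroup.of 0

def bsT (n : ℕ) : BS n := PresentedGroup.of 1

def evalLetter (n : ℕ) (l : Letter) : BS n :=
  cond l.2 (if l.1 = 0 then bsA n else bsT n) (if l.1 = 0 then (bsA n)⁻¹ else (bsT n)⁻¹)

def evalWord (n : ℕ) (wd : List Letter) : BS n := (wd.map (evalLetter n)).prod

noncomputable def wordLength (n : ℕ) (g : BS n) : ℕ :=
  sInf {N : ℕ | ∃ wd : List Letter, evalWord n wd = g ∧ wd.length = N}

def bsSphere (n N : ℕ) : Set (BS n) := {g : BS n | wordLength n g = N}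

/-- Sum of absolute values of balanced base `2α+1` digits. -/
def bw (α : ℕ) (y : ℤ) : ℕ :=
  if h : 1 ≤ α ∧ y ≠ 0 then
    ((y + α) % (2 * α + 1) - α).natAbs + bw α ((y + α) / (2 * α + 1))
  else 0
termination_by y.natAbs
decreasing_by
  obtain ⟨h1, h2⟩ := h
  have e := Int.emod_add_mul_ediv (y + α) (2 * α + 1)
  have l1 := Int.emod_nonneg (y + α) (b := 2 * α + 1) (by omega)
  have l2 := Int.emod_lt_of_pos (y + α) (b := 2 * α + 1) (by omega)
  set q := (y + α) / (2 * α + 1)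
  set c := (y + α) % (2 * α + 1)
  have h1' : (1 : ℤ) ≤ α := by exact_mod_cast h1
  zify
  rcases lt_trichotomy y 0 with hy | hy | hy
  · have : q ≤ 0 := by nlinarith
    rw [abs_of_nonpos this, abs_of_neg hy]
    nlinarith
  · exact absurd hy h2
  · have : 0 ≤ q := by nlinarith
    rw [abs_of_nonneg this, abs_of_pos hy]
    nlinarith

theorem bw_zero (α : ℕ) : bw α 0 = 0 := by
  rw [bw]; simp

theorem bw_digit {α : ℕ} (hα : 1 ≤ α) (c y : ℤ) (h1 : -(α : ℤ) ≤ c) (h2 : c ≤ α) :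
    bw α (c + (2 * α + 1) * y) = c.natAbs + bw α y := by
  by_cases h : c + (2 * α + 1) * y = 0
  · have hy : y = 0 := by
      have h1' : (1 : ℤ) ≤ α := by exact_mod_cast hα
      rcases lt_trichotomy y 0 with hy | hy | hy
      · nlinarith
      · exact hy
      · nlinarith
    subst hy
    have : c = 0 := by simpa using h
    subst this
    simp
  · rw [bw, dif_pos ⟨hα, h⟩]
    have e1 : (c + (2 * α + 1) * y + α) % (2 * α + 1) = c + α := by
      rw [show c + (2 * α + 1) * y + (α : ℤ) = (c + α) + (2 * α + 1) * y by ring,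
        Int.add_mul_emod_self_left]
      exact Int.emod_eq_of_lt (by omega) (by omega)
    have e2 : (c + (2 * α + 1) * y + α) / (2 * α + 1) = y := by
      rw [show c + (2 * α + 1) * y + (α : ℤ) = (c + α) + (2 * α + 1) * y by ring,
        Int.add_mul_ediv_left _ _ (by omega), Int.ediv_eq_zero_of_lt (by omega) (by omega)]
      simp
    rw [e1, e2]; simp

theorem bw_decomp (α : ℕ) (y : ℤ) :
    ∃ c q : ℤ, -(α : ℤ) ≤ c ∧ c ≤ α ∧ y = c + (2 * α + 1) * q := by
  have e := Int.emod_add_mul_ediv (y + α) (2 * α + 1)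
  have l1 := Int.emod_nonneg (y + α) (b := 2 * α + 1) (by omega)
  have l2 := Int.emod_lt_of_pos (y + α) (b := 2 * α + 1) (by omega)
  exact ⟨(y + α) % (2 * α + 1) - α, (y + α) / (2 * α + 1), by omega, by omega, by linarith⟩

theorem bw_mul {α : ℕ} (hα : 1 ≤ α) (y : ℤ) : bw α ((2 * α + 1) * y) = bw α y := by
  simpa using bw_digit hα 0 y (by omega) (by omega)

theorem bw_pow_mul {α : ℕ} (hα : 1 ≤ α) (P : ℕ) (y : ℤ) :
    bw α (y * (2 * α + 1) ^ P) = bw α y := by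
  induction P with
  | zero => simp
  | succ P ih =>
    rw [show y * (2 * (α : ℤ) + 1) ^ (P + 1) = (2 * α + 1) * (y * (2 * α + 1) ^ P) by ring,
      bw_mul hα, ih]

theorem bw_add_unit {α : ℕ} (hα : 1 ≤ α) (k : ℕ) : ∀ (y e : ℤ), y.natAbs ≤ k → (e = 1 ∨ e = -1) →
    bw α (y + e) ≤ bw α y + 1 := by
  have h1' : (1 : ℤ) ≤ α := by exact_mod_cast hα
  have h10 : ∀ e : ℤ, (e = 1 ∨ e = -1) → bw α e = 1 := by
    intro e he
    have := bw_digit hα e 0 (by omega) (by omega)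
    simp only [mul_zero, add_zero, bw_zero] at this
    rw [this]; omega
  induction k with
  | zero =>
    intro y e hy he
    have : y = 0 := by omega
    subst this
    rw [zero_add, h10 e he]; omega
  | succ k ih =>
    intro y e hy he
    by_cases y0 : y = 0
    · subst y0
      rw [zero_add, h10 e he]; omega
    obtain ⟨c, q, c1, c2, rfl⟩ := bw_decomp α y
    have hq : q.natAbs ≤ k := by
      suffices q.natAbs < (c + (2 * α + 1) * q).natAbs by omega
      zify
      rcases lt_trichotomy q 0 with h | h | h
      · rw [abs_of_neg h, abs_of_nonpos (by nlinarith)]; nlinarith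
      · subst h; simpa using y0
      · rw [abs_of_pos h, abs_of_nonneg (by nlinarith)]; nlinarith
    rw [bw_digit hα c q c1 c2]
    by_cases hc : -(α : ℤ) ≤ c + e ∧ c + e ≤ α
    · rw [show c + (2 * α + 1) * q + e = (c + e) + (2 * α + 1) * q by ring,
        bw_digit hα _ _ hc.1 hc.2]
      omega
    · have := ih q e hq he
      have hce : c = α * e := by rcases he with rfl | rfl <;> omega
      rw [show c + (2 * α + 1) * q + e = (-c) + (2 * α + 1) * (q + e) by rw [hce]; ring,
        bw_digit hα _ _ (by omega) (by omega)]
      omega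

theorem bw_add_pow {α : ℕ} (hα : 1 ≤ α) (P : ℕ) : ∀ (y e : ℤ), (e = 1 ∨ e = -1) →
    bw α (y + e * (2 * α + 1) ^ P) ≤ bw α y + 1 := by
  induction P with
  | zero => intro y e he; simpa using bw_add_unit hα _ y e le_rfl he
  | succ P ih =>
    intro y e he
    obtain ⟨c, q, c1, c2, rfl⟩ := bw_decomp α y
    rw [show c + (2 * α + 1) * q + e * (2 * (α : ℤ) + 1) ^ (P + 1)
      = c + (2 * α + 1) * (q + e * (2 * α + 1) ^ P) by ring, bw_digit hα _ _ c1 c2,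
      bw_digit hα _ _ c1 c2]
    have := ih q e he
    omega

/-- Main polynomial function. -/
noncomputable def pf (α : ℕ) (x : ℝ) : ℝ := x + ∑ i ∈ Finset.Icc 1 α, 2 * x ^ (i + 1)

theorem pf_strictMono (α : ℕ) {x y : ℝ} (hx : 0 ≤ x) (hxy : x < y) : pf α x < pf α y := by
  unfold pf
  apply add_lt_add_of_lt_of_le hxy
  apply Finset.sum_le_sum
  intro i _
  gcongr

theorem pf_root {α : ℕ} (hα : 1 ≤ α) : ∃ r : ℝ, 0 < r ∧ r < 1 ∧ pf α r = 1 := by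
  have hc : ContinuousOn (pf α) (Set.Icc 0 1) := by
    unfold pf; fun_prop
  have h1 : 1 < pf α 1 := by
    unfold pf
    have : (0 : ℝ) < α := by exact_mod_cast hα
    simp; omega
  have := intermediate_value_Ioo (zero_le_one) hc (show (1 : ℝ) ∈ Set.Ioo (pf α 0) (pf α 1) by
    refine ⟨by simp [pf], h1⟩)
  obtain ⟨r, hr, h⟩ := this
  exact ⟨r, hr.1, hr.2, h⟩

theorem pf_complex (α : ℕ) (r : ℝ) (hr : pf α r = 1) (z : ℂ)
    (hz : (1 - z - ∑ i ∈ Finset.Icc 1 α, 2 * z ^ (i + 1)) = 0) : r ≤ ‖z‖ := by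
  by_contra! h
  have h1 := pf_strictMono α (norm_nonneg z) h
  have h2 : z + ∑ i ∈ Finset.Icc 1 α, 2 * z ^ (i + 1) = 1 := by linear_combination -hz
  have h3 : (1 : ℝ) ≤ pf α ‖z‖ := by
    calc (1 : ℝ) = ‖z + ∑ i ∈ Finset.Icc 1 α, 2 * z ^ (i + 1)‖ := by rw [h2]; simp
      _ ≤ ‖z‖ + ‖∑ i ∈ Finset.Icc 1 α, 2 * z ^ (i + 1)‖ := norm_add_le _ _
      _ ≤ ‖z‖ + ∑ i ∈ Finset.Icc 1 α, ‖2 * z ^ (i + 1)‖ := by gcongr; exact norm_sum_le _ _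
      _ = pf α ‖z‖ := by simp [pf]
  linarith

theorem pf_digits (α : ℕ) (r : ℝ) :
    ∑ c ∈ Finset.Icc (-(α : ℤ)) α, r ^ (c.natAbs + 1) = pf α r := by
  induction α with
  | zero => simp [pf]
  | succ a ih =>
    have e : Finset.Icc (-((a + 1 : ℕ) : ℤ)) ((a + 1 : ℕ) : ℤ)
        = insert (-((a + 1 : ℕ) : ℤ)) (insert ((a + 1 : ℕ) : ℤ) (Finset.Icc (-(a : ℤ)) a)) := by
      ext x; simp only [Finset.mem_Icc, Finset.mem_insert]; omega
    rw [e, Finset.sum_insert (by simp; omega), Finset.sum_insert (by simp), ih]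
    unfold pf
    rw [Finset.sum_Icc_succ_top (by omega)]
    simp only [Int.natAbs_neg, Int.natAbs_natCast]
    ring

theorem bs_rel (n : ℕ) : bsT n * bsA n * (bsT n)⁻¹ = bsA n ^ n := by
  have h : (PresentedGroup.mk (bsRels n)) (FreeGroup.of 1 * FreeGroup.of 0 * (FreeGroup.of 1)⁻¹ *
      (FreeGroup.of 0 ^ n)⁻¹) = 1 :=
    PresentedGroup.one_of_mem rfl
  simp only [map_mul, map_inv, map_pow] at h
  exact mul_inv_eq_one.mp h

theorem bs_t_zpow (n : ℕ) (y : ℤ) : bsT n * bsA n ^ y = bsA n ^ ((n : ℤ) * y) * bsT n := by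
  have h : bsT n * bsA n ^ y * (bsT n)⁻¹ = bsA n ^ ((n : ℤ) * y) := by
    rw [← conj_zpow, bs_rel, zpow_mul, zpow_natCast]
  rw [← h]; group

theorem bs_tpow_zpow (n p : ℕ) (y : ℤ) :
    bsT n ^ p * bsA n ^ y = bsA n ^ ((n : ℤ) ^ p * y) * bsT n ^ p := by
  induction p with
  | zero => simp
  | succ p ih =>
    rw [pow_succ', mul_assoc, ih, ← mul_assoc, bs_t_zpow, mul_assoc]
    congr 2
    ring

theorem bs_a_tinv (n p : ℕ) (y : ℤ) :
    bsA n ^ y * (bsT n ^ p)⁻¹ = (bsT n ^ p)⁻¹ * bsA n ^ ((n : ℤ) ^ p * y) := by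
  have := bs_tpow_zpow n p y
  rw [eq_inv_mul_iff_mul_eq, ← mul_assoc, this]; group

theorem evalWord_cons (n : ℕ) (l : Letter) (w : List Letter) :
    evalWord n (l :: w) = evalLetter n l * evalWord n w := by
  simp [evalWord]

theorem evalLetter_cases (n : ℕ) (l : Letter) :
    (∃ e : ℤ, (e = 1 ∨ e = -1) ∧ evalLetter n l = bsA n ^ e) ∨ evalLetter n l = bsT n ∨
      evalLetter n l = (bsT n)⁻¹ := by
  obtain ⟨i, b⟩ := l
  fin_cases i <;> cases b <;> simp [evalLetter]

/-- Affine action on ℚ. -/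
def bsPhi (n : ℕ) (hn : n ≠ 0) : BS n →* Equiv.Perm ℚ :=
  PresentedGroup.toGroup (f := fun i : Fin 2 =>
    if i = 0 then Equiv.addRight (1 : ℚ) else Equiv.mulLeft₀ (n : ℚ) (by exact_mod_cast hn)) (by
    intro r hr
    have hn' : (n : ℚ) ≠ 0 := by exact_mod_cast hn
    rw [bsRels, Set.mem_singleton_iff] at hr
    subst hr
    simp only [map_mul, map_inv, map_pow, FreeGroup.lift_apply_of]
    rw [mul_inv_eq_one]
    ext q
    simp [Equiv.Perm.mul_apply, mul_add, mul_inv_cancel_left₀ hn'])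

theorem bsPhi_a (n : ℕ) (hn : n ≠ 0) (y : ℤ) (q : ℚ) : bsPhi n hn (bsA n ^ y) q = q + y := by
  have : bsPhi n hn (bsA n) = Equiv.addRight (1 : ℚ) := by
    simp [bsPhi, bsA]
  rw [map_zpow, this]
  simp

theorem bsPhi_t (n : ℕ) (hn : n ≠ 0) (q : ℚ) : bsPhi n hn (bsT n) q = n * q := by
  simp [bsPhi, bsT]

theorem bsPhi_tinv (n : ℕ) (hn : n ≠ 0) (q : ℚ) : bsPhi n hn (bsT n)⁻¹ q = q / n := by
  have hn' : (n : ℚ) ≠ 0 := by exact_mod_cast hn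
  rw [map_inv, Equiv.Perm.inv_eq_iff_eq, bsPhi_t]
  field_simp

theorem bsPhi_tpow (n : ℕ) (hn : n ≠ 0) (m : ℕ) (q : ℚ) :
    bsPhi n hn (bsT n ^ m) q = n ^ m * q := by
  induction m generalizing q with
  | zero => simp
  | succ m ih =>
    rw [pow_succ, map_mul, Equiv.Perm.mul_apply, bsPhi_t, ih]; ring

theorem bs_word_lower {α : ℕ} (hα : 1 ≤ α) (wd : List Letter) :
    ∃ (A T P : ℕ) (z m : ℤ) (x : ℚ), A + T = wd.length ∧ m ≤ T ∧
      (∀ q, bsPhi (2 * α + 1) (by omega) (evalWord (2 * α + 1) wd) q = (2 * α + 1 : ℚ) ^ m * q + x) ∧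
      x * (2 * α + 1) ^ P = z ∧ bw α z ≤ A := by
  have hn' : (2 * α + 1 : ℚ) ≠ 0 := by positivity
  induction wd with
  | nil => exact ⟨0, 0, 0, 0, 0, 0, by simp, by simp, by simp [evalWord], by simp, by simp [bw_zero]⟩
  | cons l w ih =>
    obtain ⟨A, T, P, z, m, x, h1, h2, h3, h4, h5⟩ := ih
    simp only [evalWord_cons, map_mul, Equiv.Perm.mul_apply, h3]
    rcases evalLetter_cases (2 * α + 1) l with ⟨e, he, hl⟩ | hl | hl
    · refine ⟨A + 1, T, P, z + e * (2 * α + 1) ^ P, m, x + e, by simp; omega, h2, ?_, ?_, ?_⟩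
      · intro q; rw [hl, bsPhi_a]; ring
      · push_cast; rw [← h4]; ring
      · exact (bw_add_pow hα P z e he).trans (by omega)
    · refine ⟨A, T + 1, P, (2 * α + 1) * z, m + 1, (2 * α + 1) * x, by simp; omega,
        by push_cast; omega, ?_, ?_, ?_⟩
      · intro q; rw [hl, bsPhi_t, zpow_add_one₀ hn']; push_cast; ring
      · push_cast; rw [← h4]; ring
      · rwa [bw_mul hα]
    · refine ⟨A, T + 1, P + 1, z, m - 1, x / (2 * α + 1), by simp; omega,
        by push_cast; omega, ?_, ?_, h5⟩
      · intro q; rw [hl, bsPhi_tinv, zpow_sub_one₀ hn']; push_cast; field_simp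
      · rw [← h4, pow_succ]; field_simp

theorem bsPhi_at {α : ℕ} (y : ℤ) (m : ℕ) (q : ℚ) :
    bsPhi (2 * α + 1) (by omega) (bsA _ ^ y * bsT _ ^ m) q = (2 * α + 1 : ℚ) ^ (m : ℤ) * q + y := by
  rw [map_mul, Equiv.Perm.mul_apply, bsPhi_tpow, bsPhi_a]; push_cast; simp

theorem zpow_base_inj {α : ℕ} (hα : 1 ≤ α) (a b : ℤ) (x y : ℚ)
    (h : ∀ q : ℚ, (2 * α + 1 : ℚ) ^ a * q + x = (2 * α + 1 : ℚ) ^ b * q + y) : a = b ∧ x = y := by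
  have h0 := h 0
  have h1 := h 1
  simp only [mul_zero, zero_add] at h0
  subst h0
  have h2 : (2 * α + 1 : ℚ) ^ a = (2 * α + 1 : ℚ) ^ b := by linarith
  have : (1 : ℚ) ≤ α := by exact_mod_cast hα
  exact ⟨zpow_right_injective₀ (by linarith) (by linarith) h2, rfl⟩

theorem bs_at_inj {α : ℕ} (hα : 1 ≤ α) :
    Function.Injective (fun p : ℤ × ℕ => bsA (2 * α + 1) ^ p.1 * bsT (2 * α + 1) ^ p.2) := by
  rintro ⟨y, m⟩ ⟨y', m'⟩ h
  simp only at h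
  have := zpow_base_inj hα m m' y y' (fun q => by rw [← bsPhi_at, h, bsPhi_at])
  ext
  · exact_mod_cast this.2
  · exact_mod_cast this.1

theorem bs_lower_len {α : ℕ} (hα : 1 ≤ α) (y : ℤ) (m : ℕ) (wd : List Letter)
    (h : evalWord (2 * α + 1) wd = bsA _ ^ y * bsT _ ^ m) : bw α y + m ≤ wd.length := by
  obtain ⟨A, T, P, z, m', x, h1, h2, h3, h4, h5⟩ := bs_word_lower hα wd
  obtain ⟨rfl, rfl⟩ := zpow_base_inj hα m m' y x (fun q => by rw [← bsPhi_at, ← h, h3])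
  have hz : z = y * (2 * α + 1) ^ P := by exact_mod_cast h4.symm
  rw [hz, bw_pow_mul hα] at h5
  omega

theorem bs_finite (n N : ℕ) (hN : N ≠ 0) :
    bsSphere n N ⊆ (evalWord n) '' {wd | wd.length = N} := by
  intro g hg
  have hg' : wordLength n g = N := hg
  unfold wordLength at hg'
  rcases Set.eq_empty_or_nonempty {N : ℕ | ∃ wd : List Letter, evalWord n wd = g ∧ wd.length = N}
    with h | h
  · rw [h, Nat.sInf_empty] at hg'; exact absurd hg'.symm hN
  · have := Nat.sInf_mem h
    rw [hg'] at this
    obtain ⟨wd, h1, h2⟩ := this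
    exact ⟨wd, h2, h1⟩

theorem bs_sphere_finite (n N : ℕ) (hN : N ≠ 0) : (bsSphere n N).Finite :=
  ((List.finite_length_eq Letter N).image _).subset (bs_finite n N hN)

theorem word_apow (n : ℕ) (c : ℤ) : ∃ w : List Letter, evalWord n w = bsA n ^ c ∧
    w.length = c.natAbs := by
  rcases le_total 0 c with h | h
  · refine ⟨List.replicate c.natAbs (0, true), ?_, by simp⟩
    have : (c.natAbs : ℤ) = c := by omega
    simp only [evalWord, List.map_replicate, List.prod_replicate, evalLetter]
    conv_rhs => rw [← this, zpow_natCast]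
    simp
  · refine ⟨List.replicate c.natAbs (0, false), ?_, by simp⟩
    have : -(c.natAbs : ℤ) = c := by omega
    simp only [evalWord, List.map_replicate, List.prod_replicate, evalLetter]
    conv_rhs => rw [← this, zpow_neg, zpow_natCast]
    simp

theorem bs_lower_set {α : ℕ} (hα : 1 ≤ α) {r : ℝ} (r0 : 0 < r) (r1 : r < 1) (hr : pf α r = 1)
    (N : ℕ) : ∃ S : Finset (ℤ × ℕ), (∀ p ∈ S, bw α p.1 + p.2 = N ∧
      ∃ wd, evalWord (2 * α + 1) wd = bsA _ ^ p.1 * bsT _ ^ p.2 ∧ wd.length = N) ∧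
      r ^ α * (1 / r) ^ N ≤ (S.card : ℝ) := by
  induction N using Nat.strong_induction_on with
  | _ N ih =>
  by_cases hN : N ≤ α
  · refine ⟨{(0, N)}, ?_, ?_⟩
    · simp only [Finset.mem_singleton, forall_eq, bw_zero, zero_add, zpow_zero, one_mul, true_and]
      refine ⟨List.replicate N (1, true), ?_, by simp⟩
      simp [evalWord, evalLetter]
    · obtain ⟨k, rfl⟩ := Nat.exists_eq_add_of_le hN
      rw [pow_add, one_div, inv_pow, Finset.card_singleton]
      field_simp
      simpa using pow_le_one₀ r0.le r1.le
  · choose! S hS1 hS2 using ih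
    have hlt : ∀ c ∈ Finset.Icc (-(α : ℤ)) α, c.natAbs + 1 ≤ N := by
      intro c hc; rw [Finset.mem_Icc] at hc; omega
    let f : ℤ → ℤ × ℕ → ℤ × ℕ := fun c p => (c + (2 * α + 1) * p.1, p.2 + 1)
    have hf : ∀ c, Function.Injective (f c) := by
      rintro c ⟨y, m⟩ ⟨y', m'⟩ h
      simp only [f, Prod.mk.injEq, add_right_inj, add_left_inj] at h
      obtain ⟨h1, rfl⟩ := h
      have : y = y' := mul_left_cancel₀ (by omega) h1
      rw [this]
    refine ⟨(Finset.Icc (-(α : ℤ)) α).biUnion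
      (fun c => (S (N - (c.natAbs + 1))).image (f c)), ?_, ?_⟩
    · intro p hp
      simp only [Finset.mem_biUnion, Finset.mem_image] at hp
      obtain ⟨c, hc, ⟨y, m⟩, hym, rfl⟩ := hp
      have hl := hlt c hc
      rw [Finset.mem_Icc] at hc
      obtain ⟨h1, wd, h2, h3⟩ := hS1 (N - (c.natAbs + 1)) (by omega) _ hym
      obtain ⟨w', h4, h5⟩ := word_apow (2 * α + 1) c
      simp only at h1 h2
      refine ⟨?_, w' ++ (1, true) :: wd, ?_, ?_⟩
      · simp only [f]; rw [bw_digit hα _ _ hc.1 hc.2]; omega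
      · have : evalWord (2 * α + 1) (w' ++ (1, true) :: wd)
            = evalWord (2 * α + 1) w' * (bsT _ * evalWord (2 * α + 1) wd) := by
          simp [evalWord, evalLetter]
        rw [this, h4, h2, ← mul_assoc (bsT _), bs_t_zpow]
        simp only [f]
        rw [zpow_add, pow_succ']
        push_cast
        simp only [mul_assoc]
      · rw [List.length_append, List.length_cons, h5, h3]; omega
    · rw [Finset.card_biUnion]
      · push_cast
        calc r ^ α * (1 / r) ^ N
            = r ^ α * (1 / r) ^ N * ∑ c ∈ Finset.Icc (-(α : ℤ)) α, r ^ (c.natAbs + 1) := by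
              rw [pf_digits, hr, mul_one]
          _ = ∑ c ∈ Finset.Icc (-(α : ℤ)) α, r ^ α * (1 / r) ^ (N - (c.natAbs + 1)) := by
              rw [Finset.mul_sum]
              apply Finset.sum_congr rfl
              intro c hc
              obtain ⟨k, hk⟩ := Nat.exists_eq_add_of_le (hlt c hc)
              rw [show N - (c.natAbs + 1) = k by omega, hk, pow_add (1 / r), one_div,
                inv_pow r (c.natAbs + 1)]
              have : r ^ (c.natAbs + 1) ≠ 0 := by positivity
              field_simp
          _ ≤ _ := by
              apply Finset.sum_le_sum
              intro c hc
              rw [Finset.card_image_of_injective _ (hf c)]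
              have := hlt c hc
              exact hS2 _ (by omega)
      · intro c hc c' hc' hne
        change Disjoint _ _
        rw [Finset.disjoint_left]
        intro p hp hp'
        simp only [Finset.mem_image, Finset.coe_Icc, Set.mem_Icc] at hp hp' hc hc'
        obtain ⟨⟨y, m⟩, -, rfl⟩ := hp
        obtain ⟨⟨y', m'⟩, -, h⟩ := hp'
        simp only [f, Prod.mk.injEq] at h
        apply hne
        have hd : (2 * (α : ℤ) + 1) ∣ c - c' := ⟨y' - y, by linarith [h.1]⟩
        have := Int.eq_zero_of_abs_lt_dvd hd (by rw [abs_lt]; constructor <;> omega)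
        omega

theorem bs_lower {α : ℕ} (hα : 1 ≤ α) {r : ℝ} (r0 : 0 < r) (r1 : r < 1) (hr : pf α r = 1)
    (N : ℕ) (hN : N ≠ 0) :
    r ^ α * (1 / r) ^ N ≤ ((bsSphere (2 * α + 1) N).ncard : ℝ) := by
  classical
  obtain ⟨S, h1, h2⟩ := bs_lower_set hα r0 r1 hr N
  refine h2.trans ?_
  norm_cast
  rw [← Finset.card_image_of_injective S (bs_at_inj hα), ← Set.ncard_coe_finset]
  apply Set.ncard_le_ncard _ (bs_sphere_finite _ _ hN)
  intro g hg
  simp only [Finset.coe_image, Set.mem_image, Finset.mem_coe] at hg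
  obtain ⟨p, hp, rfl⟩ := hg
  obtain ⟨h3, wd, h4, h5⟩ := h1 p hp
  change sInf _ = N
  apply le_antisymm
  · exact Nat.sInf_le ⟨wd, h4, h5⟩
  · refine le_csInf ⟨N, wd, h4, h5⟩ ?_
    rintro M ⟨wd', h6, rfl⟩
    rw [← h3]
    exact bs_lower_len hα _ _ _ h6

/-! Upper bound -/

theorem bs_word_upper {α : ℕ} (hα : 1 ≤ α) (wd : List Letter) :
    ∃ (A T p k : ℕ) (y : ℤ), A + T = wd.length ∧ p ≤ T ∧ k ≤ T ∧
      evalWord (2 * α + 1) wd = (bsT _ ^ p)⁻¹ * bsA _ ^ y * bsT _ ^ k ∧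
      |y| ≤ A * (2 * α + 1) ^ T ∧ bw α y ≤ A := by
  induction wd with
  | nil => exact ⟨0, 0, 0, 0, 0, by simp, by simp, by simp, by simp [evalWord], by simp,
      by simp [bw_zero]⟩
  | cons l w ih =>
    obtain ⟨A, T, p, k, y, h1, h2, h3, h4, h5, h6⟩ := ih
    simp only [evalWord_cons, h4]
    have hmono : (A : ℤ) * (2 * α + 1) ^ T ≤ A * (2 * α + 1) ^ (T + 1) := by
      gcongr <;> omega
    rcases evalLetter_cases (2 * α + 1) l with ⟨e, he, hl⟩ | hl | hl
    · refine ⟨A + 1, T, p, k, y + e * (2 * α + 1) ^ p, by simp; omega, h2, h3, ?_, ?_, ?_⟩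
      · rw [hl, ← mul_assoc, ← mul_assoc, bs_a_tinv, mul_assoc (bsT _ ^ p)⁻¹, ← zpow_add]
        congr 3
        push_cast; ring
      · have : |e * (2 * (α : ℤ) + 1) ^ p| ≤ (2 * α + 1) ^ T := by
          have e1 : |e| = 1 := by rcases he with rfl | rfl <;> simp
          rw [abs_mul, e1, one_mul, abs_of_nonneg (by positivity)]
          gcongr; omega
        calc _ ≤ |y| + |e * (2 * (α : ℤ) + 1) ^ p| := abs_add_le _ _
          _ ≤ _ := by push_cast; linarith
      · exact (bw_add_pow hα p y e he).trans (by omega)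
    · rw [hl]
      rcases p with _ | p
      · refine ⟨A, T + 1, 0, k + 1, (2 * α + 1) * y, by simp; omega, by omega, by omega, ?_, ?_, ?_⟩
        · simp only [pow_zero, inv_one, one_mul]
          rw [← mul_assoc, bs_t_zpow, pow_succ']
          push_cast
          rw [mul_assoc]
        · rw [abs_mul, abs_of_nonneg (by positivity : (0 : ℤ) ≤ 2 * α + 1), pow_succ]
          nlinarith
        · rwa [bw_mul hα]
      · refine ⟨A, T + 1, p, k, y, by simp; omega, by omega, by omega, ?_, by linarith, h6⟩
        rw [pow_succ]; group
    · rw [hl]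
      refine ⟨A, T + 1, p + 1, k, y, by simp; omega, by omega, by omega, ?_, by linarith, h6⟩
      rw [pow_succ]; group

theorem bw_count {α : ℕ} (hα : 1 ≤ α) {r : ℝ} (r0 : 0 < r) (r1 : r < 1) (hr : pf α r = 1)
    (K T : ℕ) : ∀ A : ℕ, ∃ Y : Finset ℤ, (∀ y : ℤ, |y| ≤ K * (2 * α + 1) ^ T → bw α y ≤ A → y ∈ Y) ∧
      (Y.card : ℝ) ≤ (2 * K + 1) * (1 / r) ^ (A + T) := by
  induction T with
  | zero =>
    intro A
    refine ⟨Finset.Icc (-K) K, ?_, ?_⟩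
    · intro y hy _
      rw [pow_zero, mul_one, abs_le] at hy
      exact Finset.mem_Icc.mpr hy
    · have h1 : 1 ≤ (1 / r) ^ (A + 0) := one_le_pow₀ (by rw [le_div_iff₀ r0]; linarith)
      have h2 : ((Finset.Icc (-(K : ℤ)) K).card : ℝ) = 2 * K + 1 := by
        rw [Int.card_Icc]
        have : ((K : ℤ) + 1 - -(K : ℤ)).toNat = 2 * K + 1 := by omega
        rw [this]; push_cast; ring
      rw [h2]
      exact le_mul_of_one_le_right (by positivity) h1
  | succ T ih =>
    intro A
    choose Y hY1 hY2 using ih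
    refine ⟨((Finset.Icc (-(α : ℤ)) α).filter (fun c => c.natAbs ≤ A)).biUnion
      (fun c => (Y (A - c.natAbs)).image (fun q => c + (2 * α + 1) * q)), ?_, ?_⟩
    · intro y hy hw
      obtain ⟨c, q, c1, c2, rfl⟩ := bw_decomp α y
      rw [bw_digit hα c q c1 c2] at hw
      simp only [Finset.mem_biUnion, Finset.mem_filter, Finset.mem_Icc, Finset.mem_image]
      refine ⟨c, ⟨⟨c1, c2⟩, by omega⟩, q, hY1 _ q ?_ (by omega), rfl⟩
      rw [pow_succ] at hy
      rw [abs_le] at hy ⊢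
      set M : ℤ := K * (2 * α + 1) ^ T with hM
      have hy1 : -(M * (2 * α + 1)) ≤ c + (2 * α + 1) * q := by rw [hM]; linarith [hy.1]
      have hy2 : c + (2 * α + 1) * q ≤ M * (2 * α + 1) := by rw [hM]; linarith [hy.2]
      constructor
      · by_contra! hlt
        have : q + 1 ≤ -M := hlt
        nlinarith
      · by_contra! hlt
        have : M + 1 ≤ q := hlt
        nlinarith
    · calc _ ≤ ((∑ c ∈ (Finset.Icc (-(α : ℤ)) α).filter (fun c => c.natAbs ≤ A),
              (Y (A - c.natAbs)).card : ℕ) : ℝ) := by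
            norm_cast
            refine Finset.card_biUnion_le.trans (Finset.sum_le_sum fun c _ => Finset.card_image_le)
        _ ≤ ∑ c ∈ (Finset.Icc (-(α : ℤ)) α).filter (fun c => c.natAbs ≤ A),
              (2 * K + 1) * (1 / r) ^ (A + (T + 1)) * r ^ (c.natAbs + 1) := by
            push_cast
            apply Finset.sum_le_sum
            intro c hc
            rw [Finset.mem_filter] at hc
            refine (hY2 _).trans (le_of_eq ?_)
            rw [show A + (T + 1) = (A - c.natAbs + T) + (c.natAbs + 1) by omega,
              pow_add (1 / r) (A - c.natAbs + T), one_div,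
              inv_pow r (c.natAbs + 1)]
            have : r ^ (c.natAbs + 1) ≠ 0 := by positivity
            field_simp
        _ ≤ ∑ c ∈ Finset.Icc (-(α : ℤ)) α,
              (2 * K + 1) * (1 / r) ^ (A + (T + 1)) * r ^ (c.natAbs + 1) := by
            apply Finset.sum_le_sum_of_subset_of_nonneg (Finset.filter_subset _ _)
            intros; positivity
        _ = _ := by rw [← Finset.mul_sum, pf_digits, hr, mul_one]

theorem bs_upper {α : ℕ} (hα : 1 ≤ α) {r : ℝ} (r0 : 0 < r) (r1 : r < 1) (hr : pf α r = 1)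
    (N : ℕ) (hN : N ≠ 0) :
    ((bsSphere (2 * α + 1) N).ncard : ℝ) ≤ (2 * N + 1) ^ 4 * (1 / r) ^ N := by
  classical
  choose Y hY1 hY2 using fun T => bw_count hα r0 r1 hr N T (N - T)
  let R := Finset.range (N + 1)
  let F : Finset (BS (2 * α + 1)) := R.biUnion fun T => R.biUnion fun p => R.biUnion fun k =>
    (Y T).image fun y => (bsT _ ^ p)⁻¹ * bsA _ ^ y * bsT _ ^ k
  have hsub : bsSphere (2 * α + 1) N ⊆ F := by
    intro g hg
    obtain ⟨wd, hw, rfl⟩ := bs_finite _ _ hN hg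
    obtain ⟨A, T, p, k, y, h1, h2, h3, h4, h5, h6⟩ := bs_word_upper hα wd
    have hw' : wd.length = N := hw
    simp only [F, R, Finset.coe_biUnion, Finset.coe_range, Set.mem_iUnion, Finset.mem_coe,
      Finset.mem_biUnion, Finset.mem_range, Finset.mem_image, Set.mem_Iio]
    refine ⟨T, by omega, p, by omega, k, by omega, y, hY1 T y ?_ (by omega), h4.symm⟩
    refine h5.trans ?_
    gcongr
    omega
  have hcard : (F.card : ℝ) ≤ ∑ T ∈ R, ∑ p ∈ R, ∑ k ∈ R, ((Y T).card : ℝ) := by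
    norm_cast
    refine Finset.card_biUnion_le.trans (Finset.sum_le_sum fun T _ => ?_)
    refine Finset.card_biUnion_le.trans (Finset.sum_le_sum fun p _ => ?_)
    refine Finset.card_biUnion_le.trans (Finset.sum_le_sum fun k _ => Finset.card_image_le)
  have h1 : ((bsSphere (2 * α + 1) N).ncard : ℝ) ≤ F.card := by
    norm_cast
    rw [← Set.ncard_coe_finset]
    exact Set.ncard_le_ncard hsub (Finset.finite_toSet _)
  refine h1.trans (hcard.trans ?_)
  have h2 : ∑ T ∈ R, ∑ p ∈ R, ∑ k ∈ R, ((Y T).card : ℝ) ≤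
      ∑ T ∈ R, ∑ p ∈ R, ∑ k ∈ R, ((2 * N + 1) * (1 / r) ^ N : ℝ) := by
    refine Finset.sum_le_sum fun T hT => Finset.sum_le_sum fun p _ => Finset.sum_le_sum fun k _ => ?_
    have := hY2 T
    have hT' : T ≤ N := by simp only [R, Finset.mem_range] at hT; omega
    rwa [Nat.sub_add_cancel hT'] at this
  refine h2.trans ?_
  simp only [Finset.sum_const, nsmul_eq_mul, R, Finset.card_range]
  push_cast
  have h3 : (N + 1 : ℝ) ≤ 2 * N + 1 := by
    have : (0 : ℝ) ≤ N := by positivity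
    linarith
  calc ((N + 1 : ℝ)) * ((N + 1) * ((N + 1) * ((2 * N + 1) * (1 / r) ^ N)))
      ≤ (2 * N + 1) * ((2 * N + 1) * ((2 * N + 1) * ((2 * N + 1) * (1 / r) ^ N))) := by gcongr
    _ = _ := by ring

theorem bs_limit {α : ℕ} (hα : 1 ≤ α) {r : ℝ} (r0 : 0 < r) (r1 : r < 1) (hr : pf α r = 1) :
    Tendsto (fun N : ℕ => ((bsSphere (2 * α + 1) N).ncard : ℝ) ^ (1 / (N : ℝ)))
        atTop (𝓝 (1 / r)) := by
  have hinv : Tendsto (fun N : ℕ => 1 / (N : ℝ)) atTop (𝓝 0) := tendsto_one_div_atTop_nhds_zero_nat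
  have hroot : ∀ N : ℕ, N ≠ 0 → ((1 / r) ^ N) ^ (1 / (N : ℝ)) = 1 / r := by
    intro N hN
    rw [one_div (N : ℝ)]
    exact Real.pow_rpow_inv_natCast (by positivity) hN
  have hl : Tendsto (fun N : ℕ => (r ^ α) ^ (1 / (N : ℝ)) * (1 / r)) atTop (𝓝 (1 / r)) := by
    have : Tendsto (fun N : ℕ => (r ^ α) ^ (1 / (N : ℝ))) atTop (𝓝 ((r ^ α) ^ (0 : ℝ))) :=
      tendsto_const_nhds.rpow hinv (Or.inl (by positivity))
    rw [Real.rpow_zero] at this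
    simpa using this.mul_const (1 / r)
  have hu : Tendsto (fun N : ℕ => ((2 * N + 1 : ℝ) ^ (1 / (N : ℝ))) ^ 4 * (1 / r)) atTop
      (𝓝 (1 / r)) := by
    have h2 : Tendsto (fun N : ℕ => (2 * N + 1 : ℝ) ^ (1 / (N : ℝ))) atTop (𝓝 1) := by
      have hN : Tendsto (fun N : ℕ => (2 * N + 1 : ℝ)) atTop atTop :=
        tendsto_atTop_add_const_right _ _
          ((tendsto_natCast_atTop_atTop (R := ℝ)).const_mul_atTop two_pos)
      have h3 := ((tendsto_rpow_div_mul_add 2 1 (-1) (by norm_num)).comp hN)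
      refine h3.congr' ?_
      filter_upwards [eventually_ne_atTop 0] with N hN
      simp only [Function.comp]
      congr 1
      have : (N : ℝ) ≠ 0 := by exact_mod_cast hN
      rw [show (1 * (2 * (N : ℝ) + 1) + -1) = 2 * N by ring]
      field_simp
    simpa using (h2.pow 4).mul_const (1 / r)
  refine tendsto_of_tendsto_of_tendsto_of_le_of_le' hl hu ?_ ?_
  · filter_upwards [eventually_ne_atTop 0] with N hN
    have := bs_lower hα r0 r1 hr N hN
    calc _ = (r ^ α * (1 / r) ^ N) ^ (1 / (N : ℝ)) := by
          rw [Real.mul_rpow (by positivity) (by positivity), hroot N hN]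
      _ ≤ _ := Real.rpow_le_rpow (by positivity) this (by positivity)
  · filter_upwards [eventually_ne_atTop 0] with N hN
    have := bs_upper hα r0 r1 hr N hN
    calc _ ≤ ((2 * N + 1) ^ 4 * (1 / r) ^ N) ^ (1 / (N : ℝ)) :=
          Real.rpow_le_rpow (by positivity) this (by positivity)
      _ = _ := by
          rw [Real.mul_rpow (by positivity) (by positivity), hroot N hN,
            ← Real.rpow_natCast, ← Real.rpow_natCast, ← Real.rpow_mul (by positivity),
            ← Real.rpow_mul (by positivity), mul_comm (1 / (N : ℝ))]

/-- The growth rate of `BS(1,n)` for odd `n ≥ 3`: the polynomial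
`1 - x - ∑_{i=1}^α 2x^{i+1}` (with `α = (n-1)/2`) has a unique real root `r` in `(0,1)`,
which is its root of smallest magnitude, and `lim |S_n(N)|^{1/N} = 1/r`. -/
theorem growth_rate_BS_odd (n α : ℕ) (hn : 3 ≤ n) (hodd : Odd n) (hα : α = (n - 1) / 2) :
    ∃ r : ℝ, (0 < r ∧ r < 1) ∧
      (1 - r - ∑ i ∈ Finset.Icc 1 α, 2 * r ^ (i + 1)) = 0 ∧
      (∀ r' : ℝ, 0 < r' → r' < 1 →
        (1 - r' - ∑ i ∈ Finset.Icc 1 α, 2 * r' ^ (i + 1)) = 0 → r' = r) ∧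
      (∀ z : ℂ, (1 - z - ∑ i ∈ Finset.Icc 1 α, 2 * z ^ (i + 1)) = 0 → r ≤ ‖z‖) ∧
      Tendsto (fun N : ℕ => ((bsSphere n N).ncard : ℝ) ^ (1 / (N : ℝ)))
        atTop (𝓝 (1 / r)) := by
  have hα1 : 1 ≤ α := by omega
  have hn' : n = 2 * α + 1 := by obtain ⟨k, rfl⟩ := hodd; omega
  clear hα hn hodd
  subst hn'
  obtain ⟨r, r0, r1, hr⟩ := pf_root hα1
  refine ⟨r, ⟨r0, r1⟩, ?_, ?_, fun z hz => pf_complex α r hr z hz, bs_limit hα1 r0 r1 hr⟩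
  · unfold pf at hr; linarith
  · intro r' h0 _ h
    have h' : pf α r' = 1 := by unfold pf; linarith
    rcases lt_trichotomy r' r with hlt | heq | hlt
    · have := pf_strictMono α h0.le hlt
      linarith
    · exact heq
    · have := pf_strictMono α r0.le hlt
      linarith
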